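/- Let q > 1 be real, n ≥ 0 an integer, and x a real number with 0 < x < q^{n+2} − 1. Then (−1)^{n+1} ∑_{ℓ=n+1}^∞ x^ℓ/(q;q)_ℓ > 0; that is, the tail F_{q,>n}(x) of the series F_q(x) = ∑_{k=0}^∞ x^k/(q;q)_k has sign (−1)^{n+1}. -/

import Mathlib

/-- The `q`-Pochhammer symbol `(q;q)_k = ∏_{j=1}^k (1 - q^j)`. -/
def poch (q : ℝ) (k : ℕ) : ℝ := ∏ j ∈ Finset.range k, (1 - q ^ (j + 1))

/-- An alternating series whose terms decrease at least geometrically in absolute value has the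
sign of its first term. -/
theorem tsum_alternating_pos_of_ratio_le {b : ℕ → ℝ} {r : ℝ} (hr : r < 1) (hb : ∀ k, 0 < b k)
    (hle : ∀ k, b (k + 1) ≤ r * b k) : 0 < ∑' k, (-1 : ℝ) ^ k * b k := by
  have hlt (k : ℕ) : b (k + 1) < b k :=
    (hle k).trans_lt (mul_lt_of_lt_one_left (hb k) hr)
  have hsum : Summable fun k => (-1 : ℝ) ^ k * b k := by
    refine summable_of_ratio_norm_eventually_le hr (Filter.Eventually.of_forall fun k => ?_)
    simpa [abs_of_pos (hb _)] using hle k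
  have h := (antitone_nat_of_succ_le fun k => (hlt k).le).alternating_series_le_tendsto
    hsum.hasSum.tendsto_sum_nat 1
  have h2 : 0 < ∑ i ∈ Finset.range (2 * 1), (-1 : ℝ) ^ i * b i := by
    simpa [Finset.sum_range_succ] using hlt 0
  exact h2.trans_le h

theorem poch_succ (q : ℝ) (k : ℕ) : poch q (k + 1) = poch q k * (1 - q ^ (k + 1)) :=
  Finset.prod_range_succ _ _

/-- For `q > 1` the sign of `(q;q)_k` is `(-1)^k`. -/
theorem neg_one_pow_mul_poch_pos {q : ℝ} (hq : 1 < q) (k : ℕ) : 0 < (-1 : ℝ) ^ k * poch q k := by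
  induction k with
  | zero => simp [poch]
  | succ k ih =>
    have h : 0 < q ^ (k + 1) - 1 := sub_pos.2 (one_lt_pow₀ hq k.succ_ne_zero)
    calc 0 < (-1 : ℝ) ^ k * poch q k * (q ^ (k + 1) - 1) := mul_pos ih h
      _ = (-1 : ℝ) ^ (k + 1) * poch q (k + 1) := by rw [poch_succ]; ring

/-- The tail `F_{q,>n}(x) = ∑_{ℓ=n+1}^∞ x^ℓ/(q;q)_ℓ` has sign `(-1)^{n+1}`
when `0 < x < q^{n+2} - 1`. -/
theorem stmt_15 (q : ℝ) (hq : 1 < q) (n : ℕ) (x : ℝ)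
    (hx : 0 < x) (hx2 : x < q ^ (n + 2) - 1) :
    0 < (-1 : ℝ) ^ (n + 1) * ∑' ℓ : ℕ, x ^ (ℓ + n + 1) / poch q (ℓ + n + 1) := by
  have hb (m : ℕ) : 0 < x ^ m / ((-1 : ℝ) ^ m * poch q m) :=
    div_pos (pow_pos hx m) (neg_one_pow_mul_poch_pos hq m)
  have hd : 0 < q ^ (n + 2) - 1 := hx.trans hx2
  have hratio (ℓ : ℕ) :
      x ^ (ℓ + 1 + n + 1) / ((-1 : ℝ) ^ (ℓ + 1 + n + 1) * poch q (ℓ + 1 + n + 1)) ≤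
        x / (q ^ (n + 2) - 1) *
          (x ^ (ℓ + n + 1) / ((-1 : ℝ) ^ (ℓ + n + 1) * poch q (ℓ + n + 1))) := by
    have hpow : q ^ (n + 2) ≤ q ^ (ℓ + n + 1 + 1) := pow_le_pow_right₀ hq.le (by omega)
    have heq : x ^ (ℓ + n + 1 + 1) / ((-1 : ℝ) ^ (ℓ + n + 1 + 1) * poch q (ℓ + n + 1 + 1)) =
        x / (q ^ (ℓ + n + 1 + 1) - 1) *
          (x ^ (ℓ + n + 1) / ((-1 : ℝ) ^ (ℓ + n + 1) * poch q (ℓ + n + 1))) := by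
      rw [poch_succ, div_mul_div_comm]
      congr 1 <;> ring
    rw [show ℓ + 1 + n + 1 = ℓ + n + 1 + 1 by omega, heq]
    exact mul_le_mul_of_nonneg_right
      (div_le_div_of_nonneg_left hx.le hd (sub_le_sub_right hpow 1)) (hb _).le
  have h := tsum_alternating_pos_of_ratio_le ((div_lt_one hd).2 hx2)
    (fun ℓ => hb (ℓ + n + 1)) hratio
  rw [← tsum_mul_left]
  refine h.trans_eq (tsum_congr fun ℓ => ?_)
  have hsq : ((-1 : ℝ) ^ (n + 1)) * (-1) ^ (n + 1) = 1 := by rw [← mul_pow]; simp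
  have hp : poch q (ℓ + n + 1) ≠ 0 := right_ne_zero_of_mul (neg_one_pow_mul_poch_pos hq _).ne'
  rw [add_assoc ℓ n 1] at hp ⊢
  rw [pow_add (-1 : ℝ) ℓ]
  field_simp
  linear_combination -hsq
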